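/- arXiv:2402.03571 — 3 statements merged into one kernel-verified Lean document; each statement's English description precedes it below -/
import Mathlib

section
/- Let (X,d) be a metric space that is metric doubling with constants C_D ≥ 1 and α > 0. Let U ⊂ X be a connected open set, let x, y ∈ U, and let γ be a continuous curve in U from x to y such that δ_U(z) ≥ δ > 0 for all z ∈ γ. Then for any M > 1 and any r ∈ (0,δ), there exists an M-Harnack chain {B_j = B(z_j, r)}_{j=1}^{n} from x to y in U, with all centers z_j ∈ γ, whose length n is at most C_D·(1 + r^{-1}·M·diam(γ))^{α}. -/
/-- A metric space is metric doubling with constants `C_D ≥ 1` and `α > 0` if for every ball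
`B(x,r)` and every `ε ∈ (0,1]`, every finite subset of `B(x,r)` whose points have mutual
distances `≥ ε·r` has cardinality at most `C_D · ε^{-α}`. -/
def MetricDoubling (X : Type*) [MetricSpace X] (C_D α : ℝ) : Prop :=
  ∀ (x : X) (r ε : ℝ), 0 < r → ε ∈ Set.Ioc (0 : ℝ) 1 →
    ∀ S : Finset X, (↑S : Set X) ⊆ Metric.ball x r →
      (∀ p ∈ S, ∀ q ∈ S, p ≠ q → ε * r ≤ dist p q) →
      (S.card : ℝ) ≤ C_D * ε ^ (-α)

/-- An `M`-Harnack chain from `x` to `y` in `U`, given by `n` balls with centers `z j` and radii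
`ρ j` (for `j < n`): each ball is contained in `U`, `x` lies in the first ball shrunk by `M`,
`y` lies in the last ball shrunk by `M`, and consecutive shrunk balls intersect. -/
def IsHarnackChain {X : Type*} [MetricSpace X] (M : ℝ) (U : Set X) (x y : X)
    (n : ℕ) (z : ℕ → X) (ρ : ℕ → ℝ) : Prop :=
  0 < n ∧ (∀ j < n, Metric.ball (z j) (ρ j) ⊆ U) ∧
    x ∈ Metric.ball (z 0) (ρ 0 / M) ∧ y ∈ Metric.ball (z (n - 1)) (ρ (n - 1) / M) ∧
    ∀ j, j + 1 < n →
      (Metric.ball (z j) (ρ j / M) ∩ Metric.ball (z (j + 1)) (ρ (j + 1) / M)).Nonempty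

/-- If all finite `s`-separated subsets of `K` have cardinality at most `N`, then `K` has a finite
`s`-separated subset whose open `s`-balls cover `K`. -/
theorem exists_separated_finset_cover {X : Type*} [MetricSpace X] (K : Set X) {s N : ℝ}
    (hs : 0 < s)
    (hN : ∀ S : Finset X, (↑S : Set X) ⊆ K → (∀ p ∈ S, ∀ q ∈ S, p ≠ q → s ≤ dist p q) →
      (S.card : ℝ) ≤ N) :
    ∃ S : Finset X, (↑S : Set X) ⊆ K ∧ (∀ p ∈ S, ∀ q ∈ S, p ≠ q → s ≤ dist p q) ∧
      ∀ x ∈ K, ∃ p ∈ S, x ∈ Metric.ball p s := by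
  classical
  let A : Set ℕ := {n | ∃ S : Finset X, (↑S : Set X) ⊆ K ∧
    (∀ p ∈ S, ∀ q ∈ S, p ≠ q → s ≤ dist p q) ∧ S.card = n}
  have hne : A.Nonempty := ⟨0, ∅, by simp, by simp, rfl⟩
  have hbdd : BddAbove A := by
    refine ⟨⌊N⌋₊, ?_⟩
    rintro n ⟨S, hSK, hS, rfl⟩
    exact Nat.le_floor (hN S hSK hS)
  obtain ⟨S, hSK, hS, hcard⟩ := Nat.sSup_mem hne hbdd
  refine ⟨S, hSK, hS, fun x hx => ?_⟩
  by_contra! hfar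
  have hfar' : ∀ p ∈ S, s ≤ dist x p := fun p hp => by
    simpa [Metric.mem_ball] using hfar p hp
  have hxS : x ∉ S := fun h => by
    have := hfar' x h
    rw [dist_self] at this
    linarith
  have hmem : S.card + 1 ∈ A := by
    refine ⟨insert x S, ?_, ?_, Finset.card_insert_of_notMem hxS⟩
    · rw [Finset.coe_insert]
      exact Set.insert_subset hx hSK
    · intro p hp q hq hpq
      rcases Finset.mem_insert.1 hp with rfl | hpS <;>
        rcases Finset.mem_insert.1 hq with rfl | hqS
      · exact absurd rfl hpq
      · exact hfar' q hqS
      · rw [dist_comm]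
        exact hfar' p hpS
      · exact hS p hpS q hqS hpq
  have := le_csSup hbdd hmem
  omega

/-- The graph on the index set of a family of sets, joining distinct indices whose sets meet. -/
def intersectionGraph {ι X : Type*} (V : ι → Set X) : SimpleGraph ι where
  Adj i j := i ≠ j ∧ (V i ∩ V j).Nonempty
  symm := ⟨fun _ _ h => ⟨h.1.symm, by rw [Set.inter_comm]; exact h.2⟩⟩
  loopless := ⟨fun _ h => h.1 rfl⟩

/-- The intersection graph of an open cover of a preconnected set, all of whose members meet the
set, is preconnected. -/
theorem intersectionGraph_preconnected {ι X : Type*} [TopologicalSpace X] {V : ι → Set X}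
    {K : Set X} (hK : IsPreconnected K) (hV : ∀ i, IsOpen (V i)) (hcover : K ⊆ ⋃ i, V i)
    (hmeet : ∀ i, (K ∩ V i).Nonempty) : (intersectionGraph V).Preconnected := by
  intro a b
  by_contra hab
  obtain ⟨w, -, hw, hw'⟩ := hK (⋃ i ∈ {i | (intersectionGraph V).Reachable a i}, V i)
    (⋃ i ∈ {i | ¬ (intersectionGraph V).Reachable a i}, V i)
    (isOpen_biUnion fun i _ => hV i) (isOpen_biUnion fun i _ => hV i)
    (fun w hw => by
      obtain ⟨i, hi⟩ := Set.mem_iUnion.1 (hcover hw)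
      by_cases h : (intersectionGraph V).Reachable a i
      · exact Or.inl (Set.mem_biUnion (by exact h) hi)
      · exact Or.inr (Set.mem_biUnion (by exact h) hi))
    ((hmeet a).mono (Set.inter_subset_inter_right _ fun w hw =>
      Set.mem_biUnion (by exact SimpleGraph.Reachable.refl a) hw))
    ((hmeet b).mono (Set.inter_subset_inter_right _ fun w hw =>
      Set.mem_biUnion (by exact hab) hw))
  obtain ⟨i, hi, hwi⟩ := Set.mem_iUnion₂.1 hw
  obtain ⟨j, hj, hwj⟩ := Set.mem_iUnion₂.1 hw'
  have hij : i ≠ j := fun h => hj (h ▸ hi)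
  have hadj : (intersectionGraph V).Adj i j := ⟨hij, w, hwi, hwj⟩
  exact hj (hi.trans hadj.reachable)

/-- In a metric doubling space, an `s`-separated finite subset of a bounded set `K` has at most
`C_D * (1 + s⁻¹ * diam K) ^ α` elements. -/
theorem MetricDoubling.card_le_of_separated {X : Type*} [MetricSpace X] {C_D α : ℝ}
    (hdb : MetricDoubling X C_D α) {K : Set X} (hK : Bornology.IsBounded K) (hne : K.Nonempty)
    {s : ℝ} (hs : 0 < s) (S : Finset X) (hSK : (↑S : Set X) ⊆ K)
    (hS : ∀ p ∈ S, ∀ q ∈ S, p ≠ q → s ≤ dist p q) :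
    (S.card : ℝ) ≤ C_D * (1 + s⁻¹ * Metric.diam K) ^ α := by
  obtain ⟨x, hx⟩ := hne
  have hd : 0 ≤ Metric.diam K := Metric.diam_nonneg
  have hR : 0 < Metric.diam K + s := by linarith
  have hinv : 1 + s⁻¹ * Metric.diam K = (s / (Metric.diam K + s))⁻¹ := by
    field_simp
    ring
  have hε : 0 < s / (Metric.diam K + s) := div_pos hs hR
  rw [hinv, Real.inv_rpow hε.le, ← Real.rpow_neg hε.le]
  refine hdb x (Metric.diam K + s) _ hR ⟨hε, (div_le_one hR).2 (by linarith)⟩ S ?_ ?_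
  · intro p hp
    have := Metric.dist_le_diam_of_mem hK (hSK hp) hx
    rw [Metric.mem_ball]
    linarith
  · rwa [div_mul_cancel₀ _ hR.ne']

/-- **Length of Harnack chain.** In a metric doubling space with constants `C_D ≥ 1`, `α > 0`,
if `U` is a connected open set, `x, y ∈ U`, `γ` is a continuous curve in `U` from `x` to `y`
with `δ_U(z) ≥ δ > 0` for all `z ∈ γ`, then for any `M > 1` and any `r ∈ (0, δ)` there is an
`M`-Harnack chain of balls of radius `r` from `x` to `y` in `U`, with centers on `γ`, whose
length is at most `C_D · (1 + r⁻¹·M·diam(γ))^α`. -/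
theorem harnack_chain_length {X : Type*} [MetricSpace X] (C_D α : ℝ)
    (hCD : 1 ≤ C_D) (hα : 0 < α) (hdb : MetricDoubling X C_D α)
    (U : Set X) (hUopen : IsOpen U) (hUconn : IsConnected U)
    (x y : X) (hx : x ∈ U) (hy : y ∈ U)
    (γ : ℝ → X) (hγcont : ContinuousOn γ (Set.Icc 0 1))
    (hγ0 : γ 0 = x) (hγ1 : γ 1 = y) (hγU : γ '' Set.Icc 0 1 ⊆ U)
    (δ : ℝ) (hδ : 0 < δ)
    (hdist : ∀ z ∈ γ '' Set.Icc 0 1, δ ≤ Metric.infDist z Uᶜ)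
    (M r : ℝ) (hM : 1 < M) (hr : r ∈ Set.Ioo 0 δ) :
    ∃ (n : ℕ) (z : ℕ → X),
      IsHarnackChain M U x y n z (fun _ => r) ∧
      (∀ j < n, z j ∈ γ '' Set.Icc 0 1) ∧
      (n : ℝ) ≤ C_D * (1 + r⁻¹ * M * Metric.diam (γ '' Set.Icc 0 1)) ^ α := by
  obtain ⟨hr0, hrδ⟩ := hr
  have hM0 : 0 < M := by linarith
  have hs : 0 < r / M := div_pos hr0 hM0
  have hx' : x ∈ γ '' Set.Icc 0 1 := ⟨0, by simp, hγ0⟩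
  have hy' : y ∈ γ '' Set.Icc 0 1 := ⟨1, by simp, hγ1⟩
  have hbdd : Bornology.IsBounded (γ '' Set.Icc 0 1) :=
    (isCompact_Icc.image_of_continuousOn hγcont).isBounded
  have hconn : IsPreconnected (γ '' Set.Icc 0 1) := isPreconnected_Icc.image γ hγcont
  have hcard := fun S hSK hS => hdb.card_le_of_separated hbdd ⟨x, hx'⟩ hs S hSK hS
  rw [inv_div, div_eq_inv_mul M r] at hcard
  obtain ⟨S, hSK, hS, hcover⟩ := exists_separated_finset_cover _ hs hcard
  obtain ⟨p, hp, hxp⟩ := hcover x hx'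
  obtain ⟨q, hq, hyq⟩ := hcover y hy'
  have hpre : (intersectionGraph fun i : S => Metric.ball (i : X) (r / M)).Preconnected :=
    intersectionGraph_preconnected hconn (fun _ => Metric.isOpen_ball)
      (fun w hw => by
        obtain ⟨i, hi, hwi⟩ := hcover w hw
        exact Set.mem_iUnion.2 ⟨⟨i, hi⟩, hwi⟩)
      fun i => ⟨i, hSK i.2, Metric.mem_ball_self hs⟩
  obtain ⟨W, hW⟩ := (hpre ⟨p, hp⟩ ⟨q, hq⟩).exists_isPath
  have hmem : ∀ j, ((W.getVert j : S) : X) ∈ γ '' Set.Icc 0 1 := fun j => hSK (W.getVert j).2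
  refine ⟨W.length + 1, fun j => W.getVert j, ⟨Nat.succ_pos _, fun j _ w hw => ?_, ?_, ?_, ?_⟩,
    fun j _ => hmem j, ?_⟩
  · by_contra hwU
    have h₁ := Metric.infDist_le_dist_of_mem (x := ((W.getVert j : S) : X)) (Set.mem_compl hwU)
    have h₂ := hdist _ (hmem j)
    rw [Metric.mem_ball'] at hw
    linarith
  · simpa using hxp
  · simpa using hyq
  · intro j hj
    exact (W.adj_getVert_succ (by omega)).2
  · have hlen : W.length + 1 ≤ S.card := by
      simpa using hW.length_lt
    exact le_trans (by exact_mod_cast hlen) (hcard S hSK hS)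
end

section
/- Let U be an A-uniform domain in a metric space (X,d). For every x ∈ U and r > 0 such that B_U(x,r) ≠ U, and for any s ∈ (0,r), there exists a point x_s ∈ B_U(x,r) with d(x, x_s) = s and δ_U(x_s) ≥ A^{-1}·min(s, r − s). -/
/-- An `A`-uniform curve in `U` from `x` to `y`: a continuous curve `γ : [0,1] → U` from `x`
to `y` with `diam(γ) ≤ A·d(x,y)` and `δ_U(z) ≥ A⁻¹·min(d(x,z), d(y,z))` for all `z ∈ γ`. -/
def IsUniformCurve {X : Type*} [MetricSpace X] (A : ℝ) (U : Set X) (x y : X)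
    (γ : ℝ → X) : Prop :=
  ContinuousOn γ (Set.Icc 0 1) ∧ γ 0 = x ∧ γ 1 = y ∧
  γ '' Set.Icc 0 1 ⊆ U ∧
  Metric.diam (γ '' Set.Icc 0 1) ≤ A * dist x y ∧
  ∀ z ∈ γ '' Set.Icc 0 1, A⁻¹ * min (dist x z) (dist y z) ≤ Metric.infDist z Uᶜ

/-- An `A`-uniform domain: a connected, non-empty, proper open set `U ⊊ X` such that every pair
of points of `U` is joined by an `A`-uniform curve in `U`. -/
def IsUniformDomain {X : Type*} [MetricSpace X] (A : ℝ) (U : Set X) : Prop :=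
  IsOpen U ∧ IsConnected U ∧ U ≠ Set.univ ∧
  ∀ x ∈ U, ∀ y ∈ U, ∃ γ : ℝ → X, IsUniformCurve A U x y γ

/-- Let `U` be an `A`-uniform domain. For every `x ∈ U` and `r > 0` with `B_U(x,r) ≠ U`, and
any `s ∈ (0,r)`, there exists `x_s ∈ B_U(x,r)` with `d(x, x_s) = s` and
`δ_U(x_s) ≥ A⁻¹·min(s, r − s)`. -/
theorem uniform_domain_pick_point {X : Type*} [MetricSpace X] (A : ℝ) (hA : 1 ≤ A)
    (U : Set X) (hU : IsUniformDomain A U) (x : X) (hx : x ∈ U) (r : ℝ) (hr : 0 < r)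
    (hne : U ∩ Metric.ball x r ≠ U) (s : ℝ) (hs : s ∈ Set.Ioo 0 r) :
    ∃ xs ∈ U ∩ Metric.ball x r,
      dist x xs = s ∧ A⁻¹ * min s (r - s) ≤ Metric.infDist xs Uᶜ := by
  obtain ⟨-, -, -, hcurve⟩ := hU
  obtain ⟨hs0, hsr⟩ := hs
  obtain ⟨y, hyU, hy⟩ : ∃ y ∈ U, r ≤ dist x y := by
    by_contra! h
    exact hne (Set.inter_eq_left.mpr fun y hy => Metric.mem_ball'.mpr (h y hy))
  obtain ⟨γ, hγ, h0, h1, hγU, -, hδ⟩ := hcurve x hx y hyU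
  have hcont : ContinuousOn (fun t => dist x (γ t)) (Set.Icc 0 1) :=
    by fun_prop
  obtain ⟨t, ht, hts⟩ := intermediate_value_Icc zero_le_one hcont
    (show s ∈ Set.Icc (dist x (γ 0)) (dist x (γ 1)) by
      rw [h0, h1, dist_self]
      exact ⟨hs0.le, hsr.le.trans hy⟩)
  replace hts : dist x (γ t) = s := hts
  have hmem : γ t ∈ γ '' Set.Icc 0 1 := Set.mem_image_of_mem γ ht
  refine ⟨γ t, ⟨hγU hmem, Metric.mem_ball'.mpr (hts.trans_lt hsr)⟩, hts, ?_⟩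
  refine le_trans ?_ (hδ _ hmem)
  have hyt : r - s ≤ dist y (γ t) := by
    linarith [dist_triangle_right x y (γ t)]
  rw [hts]
  gcongr
end

section
/- Let U be an A-uniform domain in a metric space (X,d). Let A_1 ≥ 3, ξ ∈ ∂U, r > 0, x ∈ B_U(ξ, 2r), and let η ∈ U satisfy d(ξ, η) = A_1·r. Let γ : [0,1] → U be an A-uniform curve from η to x with γ(0) = η, γ(1) = x, and let t_0 := sup{ t ∈ [0,1] : d(η, γ(t)) < d(γ(t), x) }. Set q := (3A)^{-2}·(A_1+2)^{-1}. Then, as long as γ(t_j) ≠ x, one can choose parameters t_0 < t_1 < t_2 < … < 1 such that for each j ≥ 1, d(γ(t_j), x) = q^{j}·d(γ(t_0), x); moreover for every j ≥ 0 one has d(γ(t_j), x) ∈ ( (A_1 − 2)·q^{j}·r/2 , A·(A_1+2)·q^{j}·r ) and δ_U(γ(t_j)) ≥ (2A)^{-1}·(A_1 − 2)·q^{j}·r. -/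
/-- A continuous function on `[a, b]` that is positive at `a` and vanishes at `b` takes the values
`q ^ j * g a` along a strictly increasing sequence of times starting at `a`. -/
theorem exists_strictMono_geometric_values {g : ℝ → ℝ} {a b q : ℝ} (hab : a < b)
    (hg : ContinuousOn g (Set.Icc a b)) (ha : 0 < g a) (hb : g b = 0) (hq₀ : 0 < q) (hq₁ : q < 1) :
    ∃ t : ℕ → ℝ, t 0 = a ∧ StrictMono t ∧ (∀ j, t j ∈ Set.Ico a b) ∧
      ∀ j, g (t j) = q ^ j * g a := by
  have step : ∀ s : ℝ, ∃ u : ℝ, s ∈ Set.Ico a b → 0 < g s → u ∈ Set.Ioo s b ∧ g u = q * g s := by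
    intro s
    by_cases hs : s ∈ Set.Ico a b ∧ 0 < g s
    · obtain ⟨⟨has, hsb⟩, hpos⟩ := hs
      obtain ⟨u, hu, hgu⟩ := intermediate_value_Ioo' hsb.le
        (hg.mono (Set.Icc_subset_Icc_left has))
        (show q * g s ∈ Set.Ioo (g b) (g s) from
          ⟨by rw [hb]; positivity, mul_lt_of_lt_one_left hpos hq₁⟩)
      exact ⟨u, fun _ _ => ⟨hu, hgu⟩⟩
    · exact ⟨s, fun h h' => absurd ⟨h, h'⟩ hs⟩
  choose f hf using step
  let t : ℕ → ℝ := fun n => f^[n] a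
  have ht_succ : ∀ j, t (j + 1) = f (t j) := fun j => Function.iterate_succ_apply' f j a
  have ht : ∀ j, t j ∈ Set.Ico a b ∧ g (t j) = q ^ j * g a := by
    intro j
    induction j with
    | zero => exact ⟨⟨le_rfl, hab⟩, by simp [t]⟩
    | succ j ih =>
      obtain ⟨hmem, hval⟩ := ih
      obtain ⟨hu, hgu⟩ := hf (t j) hmem (by rw [hval]; positivity)
      rw [ht_succ]
      exact ⟨⟨hmem.1.trans hu.1.le, hu.2⟩, by rw [hgu, hval]; ring⟩
  refine ⟨t, rfl, strictMono_nat_of_lt_succ fun j => ?_, fun j => (ht j).1, fun j => (ht j).2⟩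
  rw [ht_succ]
  exact (hf (t j) (ht j).1 (by rw [(ht j).2]; positivity)).1.1

/-- The last crossing time of two continuous functions on `[a, b]`: at
`sSup {t ∈ [a, b] | f t < g t}` the two functions agree, and afterwards `g ≤ f`. -/
theorem sSup_setOf_lt_crossing {f g : ℝ → ℝ} {a b : ℝ} (hab : a ≤ b)
    (hf : ContinuousOn f (Set.Icc a b)) (hg : ContinuousOn g (Set.Icc a b))
    (ha : f a < g a) (hb : g b < f b) {s : ℝ}
    (hs : s = sSup {t ∈ Set.Icc a b | f t < g t}) :
    s ∈ Set.Ico a b ∧ f s = g s ∧ ∀ t ∈ Set.Icc s b, g t ≤ f t := by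
  set S : Set ℝ := {t ∈ Set.Icc a b | f t < g t}
  have haS : a ∈ S := ⟨⟨le_rfl, hab⟩, ha⟩
  have hSbdd : BddAbove S := ⟨b, fun t ht => ht.1.2⟩
  have hsub : S ⊆ Set.Icc a b := fun t ht => ht.1
  have has : a ≤ s := hs ▸ le_csSup hSbdd haS
  have hsb : s ≤ b := hs ▸ csSup_le ⟨a, haS⟩ fun t ht => ht.1.2
  have hle : f s ≤ g s :=
    ContinuousWithinAt.closure_le (hs ▸ csSup_mem_closure ⟨a, haS⟩ hSbdd)
      ((hf s ⟨has, hsb⟩).mono hsub) ((hg s ⟨has, hsb⟩).mono hsub) fun t ht => ht.2.le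
  have hlt : s < b := lt_of_le_of_ne hsb fun h => by
    rw [h] at hle
    exact absurd hb hle.not_gt
  have hafter : ∀ t ∈ Set.Ioc s b, g t ≤ f t := fun t ht => not_lt.1 fun h =>
    absurd (le_csSup hSbdd (show t ∈ S from ⟨⟨has.trans ht.1.le, ht.2⟩, h⟩)) (hs ▸ ht.1).not_ge
  have hsub' : Set.Ioc s b ⊆ Set.Icc a b := fun t ht => ⟨has.trans ht.1.le, ht.2⟩
  have hge : g s ≤ f s :=
    ContinuousWithinAt.closure_le (by rw [closure_Ioc hlt.ne]; exact ⟨le_rfl, hsb⟩)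
      ((hg s ⟨has, hsb⟩).mono hsub') ((hf s ⟨has, hsb⟩).mono hsub') hafter
  refine ⟨⟨has, hlt⟩, le_antisymm hle hge, fun t ht => ?_⟩
  rcases ht.1.eq_or_lt with rfl | h
  · exact hge
  · exact hafter t ⟨h, ht.2⟩

/-- Let `U` be an `A`-uniform domain, `A₁ ≥ 3`, `ξ ∈ ∂U`, `r > 0`, `x ∈ B_U(ξ, 2r)`, and
`η ∈ U` with `d(ξ,η) = A₁·r`. Let `γ : [0,1] → U` be an `A`-uniform curve from `η` to `x`, let
`t₀ := sup{t ∈ [0,1] : d(η, γ(t)) < d(γ(t), x)}` and `q := (3A)⁻²·(A₁+2)⁻¹`. Then one can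
choose parameters `t₀ < t₁ < t₂ < ⋯ < 1` with `d(γ(t_j), x) = q^j · d(γ(t₀), x)` for `j ≥ 1`;
moreover for every `j ≥ 0` one has
`d(γ(t_j), x) ∈ ((A₁−2)·q^j·r/2, A·(A₁+2)·q^j·r)` and
`δ_U(γ(t_j)) ≥ (2A)⁻¹·(A₁−2)·q^j·r`. -/
theorem uniform_curve_geometric_times {X : Type*} [MetricSpace X] (A : ℝ) (hA : 1 ≤ A)
    (U : Set X) (hU : IsUniformDomain A U) (A₁ r : ℝ) (hA₁ : 3 ≤ A₁) (hr : 0 < r)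
    (ξ : X) (hξ : ξ ∈ frontier U) (x : X) (hx : x ∈ U ∩ Metric.ball ξ (2 * r))
    (η : X) (hη : η ∈ U) (hdξη : dist ξ η = A₁ * r)
    (γ : ℝ → X) (hγ : IsUniformCurve A U η x γ)
    (t₀ : ℝ) (ht₀ : t₀ = sSup {t ∈ Set.Icc (0 : ℝ) 1 | dist η (γ t) < dist (γ t) x})
    (q : ℝ) (hq : q = ((3 * A) ^ 2)⁻¹ * (A₁ + 2)⁻¹) :
    ∃ t : ℕ → ℝ, t 0 = t₀ ∧ StrictMono t ∧ (∀ j, t j ∈ Set.Ico t₀ (1 : ℝ)) ∧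
      (∀ j, dist (γ (t j)) x = q ^ j * dist (γ t₀) x) ∧
      (∀ j, dist (γ (t j)) x ∈ Set.Ioo ((A₁ - 2) * q ^ j * r / 2) (A * (A₁ + 2) * q ^ j * r)) ∧
      (∀ j, (2 * A)⁻¹ * ((A₁ - 2) * q ^ j * r) ≤ Metric.infDist (γ (t j)) Uᶜ) := by
  obtain ⟨hcont, hγ₀, hγ₁, -, hdiam, hδ⟩ := hγ
  have hxξ : dist x ξ < 2 * r := hx.2
  have hlower : (A₁ - 2) * r < dist η x := by
    have := dist_triangle ξ x η
    rw [dist_comm ξ x, dist_comm x η] at this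
    linarith
  have hupper : dist η x < (A₁ + 2) * r := by
    have := dist_triangle η ξ x
    rw [dist_comm η ξ, dist_comm ξ x] at this
    linarith
  have hηx : 0 < dist η x := lt_trans (mul_pos (by linarith) hr) hlower
  have hcη : ContinuousOn (fun t => dist η (γ t)) (Set.Icc 0 1) := by fun_prop
  have hcx : ContinuousOn (fun t => dist (γ t) x) (Set.Icc 0 1) := by fun_prop
  obtain ⟨ht₀mem, heq, hafter⟩ := sSup_setOf_lt_crossing zero_le_one hcη hcx
    (by simpa [hγ₀] using hηx) (by simpa [hγ₁] using hηx) ht₀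
  have hD_lower : (A₁ - 2) * r / 2 < dist (γ t₀) x := by
    have := dist_triangle η (γ t₀) x
    linarith
  have hD_upper : dist (γ t₀) x < A * (A₁ + 2) * r := by
    have hbdd : Bornology.IsBounded (γ '' Set.Icc 0 1) :=
      (isCompact_Icc.image_of_continuousOn hcont).isBounded
    have hle : dist (γ t₀) x ≤ Metric.diam (γ '' Set.Icc 0 1) :=
      Metric.dist_le_diam_of_mem hbdd ⟨t₀, ⟨ht₀mem.1, ht₀mem.2.le⟩, rfl⟩
        ⟨1, ⟨zero_le_one, le_rfl⟩, hγ₁⟩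
    have : A * dist η x < A * ((A₁ + 2) * r) := mul_lt_mul_of_pos_left hupper (by linarith)
    linarith
  have hq₀ : 0 < q := by
    have : 0 < A₁ + 2 := by linarith
    have : 0 < A := by linarith
    rw [hq]
    positivity
  have hq₁ : q < 1 := by
    rw [hq, ← mul_inv]
    exact inv_lt_one_of_one_lt₀ (by nlinarith)
  have hD : 0 < dist (γ t₀) x := lt_trans (by nlinarith) hD_lower
  obtain ⟨t, ht0, hmono, hmem, hval⟩ := exists_strictMono_geometric_values ht₀mem.2
    (hcx.mono (Set.Icc_subset_Icc_left ht₀mem.1)) hD (by simp [hγ₁]) hq₀ hq₁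
  have hbounds : ∀ j, dist (γ (t j)) x ∈
      Set.Ioo ((A₁ - 2) * q ^ j * r / 2) (A * (A₁ + 2) * q ^ j * r) := by
    intro j
    have hqj : 0 < q ^ j := pow_pos hq₀ j
    have hl := mul_lt_mul_of_pos_left hD_lower hqj
    have hu := mul_lt_mul_of_pos_left hD_upper hqj
    rw [← hval j] at hl hu
    exact ⟨by linarith, by linarith⟩
  refine ⟨t, ht0, hmono, hmem, hval, hbounds, fun j => ?_⟩
  have hj := hδ (γ (t j)) ⟨t j, ⟨ht₀mem.1.trans (hmem j).1, (hmem j).2.le⟩, rfl⟩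
  have hmin : min (dist η (γ (t j))) (dist x (γ (t j))) = dist (γ (t j)) x := by
    rw [dist_comm x]
    exact min_eq_right (hafter (t j) ⟨(hmem j).1, (hmem j).2.le⟩)
  rw [hmin] at hj
  calc (2 * A)⁻¹ * ((A₁ - 2) * q ^ j * r) = A⁻¹ * ((A₁ - 2) * q ^ j * r / 2) := by
        rw [mul_inv]; ring
    _ ≤ A⁻¹ * dist (γ (t j)) x :=
        mul_le_mul_of_nonneg_left (hbounds j).1.le (inv_nonneg.2 (by linarith))
    _ ≤ Metric.infDist (γ (t j)) Uᶜ := hj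
end
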